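/- arXiv:1403.4526 — 6 statements merged into one kernel-verified Lean document; each statement's English description precedes it below -/
import Mathlib

section
/- Let Y and X be real normed vector spaces, r > 0 and L ≥ 0. Let F be defined on the closed ball B̄(0,r) of Y with values in X, Fréchet differentiable there, with derivative F' satisfying F'(0) = 0 and ‖F'(φ) − F'(ψ)‖_{L(Y,X)} ≤ L‖φ − ψ‖ for all φ, ψ ∈ B̄(0,r). Then for all a, b, c, d ∈ B̄(0,r): ‖F(a) − F(b) − F(c) + F(d)‖ ≤ (L/2)(‖a − c‖ + ‖b − d‖)‖a − b‖ + L·r·‖(a − b) − (c − d)‖. -/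
/-- A differentiable map on a convex set, restricted to a segment of that set, is differentiable
along the segment. -/
theorem hasDerivWithinAt_comp_lineMap {Y X : Type*} [NormedAddCommGroup Y] [NormedSpace ℝ Y]
    [NormedAddCommGroup X] [NormedSpace ℝ X] {s : Set Y} (hs : Convex ℝ s) {F : Y → X}
    {F' : Y → Y →L[ℝ] X} (hF : ∀ y ∈ s, HasFDerivWithinAt F (F' y) s y) {x y : Y}
    (hx : x ∈ s) (hy : y ∈ s) {t : ℝ} (ht : t ∈ Set.Icc (0 : ℝ) 1) :
    HasDerivWithinAt (fun u : ℝ => F (AffineMap.lineMap x y u))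
      (F' (AffineMap.lineMap x y t) (y - x)) (Set.Icc 0 1) t :=
  (hF _ (hs.lineMap_mem hx hy ht)).comp_hasDerivWithinAt t
    AffineMap.hasDerivWithinAt_lineMap fun _ hu => hs.lineMap_mem hx hy hu


/-- Four-point difference estimate for a map `F` on a closed ball whose
derivative vanishes at `0` and is `L`-Lipschitz on the ball. -/
theorem four_point_difference_estimate
    {Y X : Type*} [NormedAddCommGroup Y] [NormedSpace ℝ Y]
    [NormedAddCommGroup X] [NormedSpace ℝ X]
    (r L : ℝ) (hr : 0 < r) (hL : 0 ≤ L)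
    (F : Y → X) (F' : Y → Y →L[ℝ] X)
    (hdiff : ∀ y ∈ Metric.closedBall (0 : Y) r,
      HasFDerivWithinAt F (F' y) (Metric.closedBall (0 : Y) r) y)
    (hF'0 : F' 0 = 0)
    (hlip : ∀ φ ∈ Metric.closedBall (0 : Y) r, ∀ ψ ∈ Metric.closedBall (0 : Y) r,
      ‖F' φ - F' ψ‖ ≤ L * ‖φ - ψ‖) :
    ∀ a ∈ Metric.closedBall (0 : Y) r, ∀ b ∈ Metric.closedBall (0 : Y) r,
    ∀ c ∈ Metric.closedBall (0 : Y) r, ∀ d ∈ Metric.closedBall (0 : Y) r,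
      ‖F a - F b - F c + F d‖ ≤
        L / 2 * (‖a - c‖ + ‖b - d‖) * ‖a - b‖ + L * r * ‖a - b - (c - d)‖ := by
  intro a ha b hb c hc d hd
  have hs : Convex ℝ (Metric.closedBall (0 : Y) r) := convex_closedBall 0 r
  set g : ℝ → X := fun t =>
    F (AffineMap.lineMap b a t) - F (AffineMap.lineMap d c t) - (F b - F d) with hg
  set g' : ℝ → X := fun t =>
    F' (AffineMap.lineMap b a t) (a - b) - F' (AffineMap.lineMap d c t) (c - d) with hg'
  set B : ℝ → ℝ := fun t =>
    L * ‖a - b‖ * (t ^ 2 / 2 * ‖a - c‖ + (t - t ^ 2 / 2) * ‖b - d‖) +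
      L * r * ‖a - b - (c - d)‖ * t with hB
  set B' : ℝ → ℝ := fun t =>
    L * ‖a - b‖ * (t * ‖a - c‖ + (1 - t) * ‖b - d‖) + L * r * ‖a - b - (c - d)‖ with hB'
  have hgderiv : ∀ t ∈ Set.Icc (0 : ℝ) 1, HasDerivWithinAt g (g' t) (Set.Icc 0 1) t := fun t ht =>
    ((hasDerivWithinAt_comp_lineMap hs hdiff hb ha ht).sub
      (hasDerivWithinAt_comp_lineMap hs hdiff hd hc ht)).sub_const _
  have hBderiv : ∀ t, HasDerivAt B (B' t) t := by
    intro t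
    have hsq : HasDerivAt (fun u : ℝ => u ^ 2 / 2) t t := by
      simpa using (hasDerivAt_pow 2 t).div_const 2
    have h := (((hsq.mul_const ‖a - c‖).add
      (((hasDerivAt_id t).sub hsq).mul_const ‖b - d‖)).const_mul (L * ‖a - b‖)).add
      ((hasDerivAt_id t).const_mul (L * r * ‖a - b - (c - d)‖))
    exact h.congr_deriv (by simp only [hB', mul_one])
  have hbound : ∀ t ∈ Set.Ico (0 : ℝ) 1, ‖g' t‖ ≤ B' t := by
    intro t ht
    have ht' := Set.Ico_subset_Icc_self ht
    have hp := hs.lineMap_mem hb ha ht'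
    have hq := hs.lineMap_mem hd hc ht'
    set p := AffineMap.lineMap b a t with hp_def
    set q := AffineMap.lineMap d c t with hq_def
    have hpq : ‖p - q‖ ≤ t * ‖a - c‖ + (1 - t) * ‖b - d‖ := by
      have h : p - q = t • (a - c) + (1 - t) • (b - d) := by
        rw [hp_def, hq_def, AffineMap.lineMap_apply_module, AffineMap.lineMap_apply_module]
        module
      rw [h]
      refine (norm_add_le _ _).trans_eq ?_
      rw [norm_smul_of_nonneg ht.1, norm_smul_of_nonneg (sub_nonneg.2 ht.2.le)]
    have hF'q : ‖F' q‖ ≤ L * r := by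
      have h := hlip q hq 0 (Metric.mem_closedBall_self hr.le)
      rw [hF'0, sub_zero, sub_zero] at h
      exact h.trans (mul_le_mul_of_nonneg_left (mem_closedBall_zero_iff.1 hq) hL)
    calc ‖g' t‖ = ‖(F' p - F' q) (a - b) + F' q (a - b - (c - d))‖ := by
          simp only [hg', sub_apply, map_sub]
          congr 1
          abel
      _ ≤ ‖F' p - F' q‖ * ‖a - b‖ + ‖F' q‖ * ‖a - b - (c - d)‖ :=
          (norm_add_le _ _).trans
            (add_le_add (ContinuousLinearMap.le_opNorm _ _) (ContinuousLinearMap.le_opNorm _ _))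
      _ ≤ L * (t * ‖a - c‖ + (1 - t) * ‖b - d‖) * ‖a - b‖ + L * r * ‖a - b - (c - d)‖ := by
          gcongr
          exact (hlip p hp q hq).trans (mul_le_mul_of_nonneg_left hpq hL)
      _ = B' t := by simp only [hB']; ring
  have key : ‖g 1‖ ≤ B 1 :=
    image_norm_le_of_norm_deriv_right_le_deriv_boundary
      (fun t ht => (hgderiv t ht).continuousWithinAt)
      (fun t ht => (hgderiv t (Set.Ico_subset_Icc_self ht)).mono_of_mem_nhdsWithin
        (Icc_mem_nhdsGE_of_mem ht))
      (by simp [hg, hB]) hBderiv hbound (Set.right_mem_Icc.2 zero_le_one)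
  calc ‖F a - F b - F c + F d‖ = ‖g 1‖ := by
        simp only [hg, AffineMap.lineMap_apply_one]
        congr 1
        abel
    _ ≤ B 1 := key
    _ = _ := by simp only [hB]; ring
end

section
/- Let Y and X be real normed vector spaces, r > 0, L ≥ 0, and let F be defined on the closed ball B̄(0,r) of Y with values in X, Fréchet differentiable there, with derivative F' satisfying F'(0) = 0 and ‖F'(φ) − F'(ψ)‖_{L(Y,X)} ≤ L‖φ − ψ‖ for all φ, ψ ∈ B̄(0,r). Let a > 0, β ∈ (0,1], and let z₁, z₂ : [0,a] → Y satisfy: z₁(t), z₂(t) ∈ B̄(0,r) for all t; ‖zᵢ(t) − zᵢ(s)‖ ≤ Hᵢ|t − s|ᵝ for all s, t ∈ [0,a] (i = 1,2); ‖(z₁(t) − z₂(t)) − (z₁(s) − z₂(s))‖ ≤ D|t − s|ᵝ for all s, t ∈ [0,a]; and ‖z₁(t) − z₂(t)‖ ≤ M for all t ∈ [0,a]. Then for all s, t ∈ [0,a]: ‖F(z₁(t)) − F(z₂(t)) − F(z₁(s)) + F(z₂(s))‖ ≤ ((L/2)(H₁ + H₂)M + L·r·D)·|t − s|ᵝ.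 -/
/-- Four-point estimate for a map with Lipschitz derivative on a ball around a critical point. -/
theorem norm_sub_sub_add_le_of_lipschitz_fderiv
    {Y X : Type*} [NormedAddCommGroup Y] [NormedSpace ℝ Y]
    [NormedAddCommGroup X] [NormedSpace ℝ X]
    {r L : ℝ} (hr : 0 ≤ r) (hL : 0 ≤ L) {F : Y → X} {F' : Y → Y →L[ℝ] X}
    (hdiff : ∀ y ∈ Metric.closedBall (0 : Y) r,
      HasFDerivWithinAt F (F' y) (Metric.closedBall (0 : Y) r) y)
    (hF'0 : F' 0 = 0)
    (hlip : ∀ φ ∈ Metric.closedBall (0 : Y) r, ∀ ψ ∈ Metric.closedBall (0 : Y) r,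
      ‖F' φ - F' ψ‖ ≤ L * ‖φ - ψ‖)
    {u v p q : Y} (hu : u ∈ Metric.closedBall (0 : Y) r) (hv : v ∈ Metric.closedBall (0 : Y) r)
    (hp : p ∈ Metric.closedBall (0 : Y) r) (hq : q ∈ Metric.closedBall (0 : Y) r) :
    ‖F u - F v - F p + F q‖ ≤
      L / 2 * (‖u - p‖ + ‖v - q‖) * ‖u - v‖ + L * r * ‖(u - v) - (p - q)‖ := by
  have hmem : ∀ {x y : Y}, x ∈ Metric.closedBall (0 : Y) r → y ∈ Metric.closedBall (0 : Y) r →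
      Set.MapsTo (fun θ : ℝ => y + θ • (x - y)) (Set.Icc 0 1) (Metric.closedBall (0 : Y) r) :=
    fun hx hy θ hθ => (convex_closedBall (0 : Y) r).add_smul_sub_mem hy hx hθ
  have hderiv : ∀ {x y : Y}, x ∈ Metric.closedBall (0 : Y) r → y ∈ Metric.closedBall (0 : Y) r →
      ∀ θ ∈ Set.Icc (0 : ℝ) 1, HasDerivWithinAt (fun θ : ℝ => F (y + θ • (x - y)))
        (F' (y + θ • (x - y)) (x - y)) (Set.Icc 0 1) θ := by
    intro x y hx hy θ hθ
    have hline : HasDerivWithinAt (fun θ : ℝ => y + θ • (x - y)) (x - y) (Set.Icc 0 1) θ := by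
      simpa using (((hasDerivAt_id θ).smul_const (x - y)).const_add y).hasDerivWithinAt
    exact (hdiff _ (hmem hx hy hθ)).comp_hasDerivWithinAt θ hline (hmem hx hy)
  have hg : ∀ θ ∈ Set.Icc (0 : ℝ) 1, HasDerivWithinAt
      (fun θ : ℝ => F (v + θ • (u - v)) - F (q + θ • (p - q)) - (F v - F q))
      (F' (v + θ • (u - v)) (u - v) - F' (q + θ • (p - q)) (p - q)) (Set.Icc 0 1) θ :=
    fun θ hθ => ((hderiv hu hv θ hθ).sub (hderiv hp hq θ hθ)).sub_const _
  have hB : ∀ θ : ℝ, HasDerivAt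
      (fun θ : ℝ => L * ‖u - v‖ * (‖v - q‖ * (θ - θ ^ 2 / 2) + ‖u - p‖ * (θ ^ 2 / 2))
        + L * r * ‖(u - v) - (p - q)‖ * θ)
      (L * ((1 - θ) * ‖v - q‖ + θ * ‖u - p‖) * ‖u - v‖ + L * r * ‖(u - v) - (p - q)‖) θ := by
    intro θ
    have hsq : HasDerivAt (fun θ : ℝ => θ ^ 2 / 2) θ θ := by
      simpa using ((hasDerivAt_id θ).pow 2).div_const 2
    have hid := hasDerivAt_id' θ
    refine HasDerivAt.congr_deriv (((((hid.sub hsq).const_mul ‖v - q‖).add (hsq.const_mul ‖u - p‖)).const_mul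
      (L * ‖u - v‖)).add (hid.const_mul (L * r * ‖(u - v) - (p - q)‖))) ?_
    ring
  have hbound : ∀ θ ∈ Set.Ico (0 : ℝ) 1,
      ‖F' (v + θ • (u - v)) (u - v) - F' (q + θ • (p - q)) (p - q)‖ ≤
        L * ((1 - θ) * ‖v - q‖ + θ * ‖u - p‖) * ‖u - v‖ + L * r * ‖(u - v) - (p - q)‖ := by
    intro θ hθ
    have hw₁ := hmem hu hv (Set.Ico_subset_Icc_self hθ)
    have hw₂ := hmem hp hq (Set.Ico_subset_Icc_self hθ)
    have hdist : ‖(v + θ • (u - v)) - (q + θ • (p - q))‖ ≤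
        (1 - θ) * ‖v - q‖ + θ * ‖u - p‖ := by
      have heq : (v + θ • (u - v)) - (q + θ • (p - q)) =
          (1 - θ) • (v - q) + θ • (u - p) := by module
      rw [heq]
      refine (norm_add_le _ _).trans_eq ?_
      rw [norm_smul_of_nonneg (by linarith [hθ.2]), norm_smul_of_nonneg hθ.1]
    have hnorm : ‖F' (q + θ • (p - q))‖ ≤ L * r := by
      have h := hlip _ hw₂ 0 (Metric.mem_closedBall_self hr)
      rw [hF'0, sub_zero, sub_zero] at h
      exact h.trans (mul_le_mul_of_nonneg_left (mem_closedBall_zero_iff.1 hw₂) hL)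
    have hsplit : F' (v + θ • (u - v)) (u - v) - F' (q + θ • (p - q)) (p - q) =
        (F' (v + θ • (u - v)) - F' (q + θ • (p - q))) (u - v) +
          F' (q + θ • (p - q)) ((u - v) - (p - q)) := by
      rw [sub_apply, map_sub (F' (q + θ • (p - q))) (u - v) (p - q)]
      abel
    rw [hsplit]
    exact (norm_add_le _ _).trans (add_le_add
      (ContinuousLinearMap.le_of_opNorm_le _
        ((hlip _ hw₁ _ hw₂).trans (mul_le_mul_of_nonneg_left hdist hL)) _)
      (ContinuousLinearMap.le_of_opNorm_le _ hnorm _))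
  have key := image_norm_le_of_norm_deriv_right_le_deriv_boundary
    (fun θ hθ => (hg θ hθ).continuousWithinAt)
    (fun θ hθ => (hg θ (Set.Ico_subset_Icc_self hθ)).mono_of_mem_nhdsWithin
      (Icc_mem_nhdsGE_of_mem hθ))
    (by simp) hB hbound (Set.right_mem_Icc.2 zero_le_one)
  simp only [one_smul, add_sub_cancel] at key
  calc ‖F u - F v - F p + F q‖ = ‖F u - F p - (F v - F q)‖ := by congr 1; abel
    _ ≤ _ := key
    _ = _ := by ring

/-- Hölder-continuity-in-time of `F ∘ z₁ - F ∘ z₂` along two Hölder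
continuous paths with values in a closed ball, when `F'(0) = 0` and `F'` is `L`-Lipschitz
on the ball. -/
theorem holder_in_time_nonlinear_estimate
    {Y X : Type*} [NormedAddCommGroup Y] [NormedSpace ℝ Y]
    [NormedAddCommGroup X] [NormedSpace ℝ X]
    (r L : ℝ) (hr : 0 < r) (hL : 0 ≤ L)
    (F : Y → X) (F' : Y → Y →L[ℝ] X)
    (hdiff : ∀ y ∈ Metric.closedBall (0 : Y) r,
      HasFDerivWithinAt F (F' y) (Metric.closedBall (0 : Y) r) y)
    (hF'0 : F' 0 = 0)
    (hlip : ∀ φ ∈ Metric.closedBall (0 : Y) r, ∀ ψ ∈ Metric.closedBall (0 : Y) r,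
      ‖F' φ - F' ψ‖ ≤ L * ‖φ - ψ‖)
    (a : ℝ) (ha : 0 < a) (β : ℝ) (hβ : β ∈ Set.Ioc (0 : ℝ) 1)
    (z₁ z₂ : ℝ → Y) (H₁ H₂ D M : ℝ)
    (hz₁mem : ∀ t ∈ Set.Icc (0 : ℝ) a, z₁ t ∈ Metric.closedBall (0 : Y) r)
    (hz₂mem : ∀ t ∈ Set.Icc (0 : ℝ) a, z₂ t ∈ Metric.closedBall (0 : Y) r)
    (hz₁hold : ∀ s ∈ Set.Icc (0 : ℝ) a, ∀ t ∈ Set.Icc (0 : ℝ) a,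
      ‖z₁ t - z₁ s‖ ≤ H₁ * |t - s| ^ β)
    (hz₂hold : ∀ s ∈ Set.Icc (0 : ℝ) a, ∀ t ∈ Set.Icc (0 : ℝ) a,
      ‖z₂ t - z₂ s‖ ≤ H₂ * |t - s| ^ β)
    (hdifhold : ∀ s ∈ Set.Icc (0 : ℝ) a, ∀ t ∈ Set.Icc (0 : ℝ) a,
      ‖(z₁ t - z₂ t) - (z₁ s - z₂ s)‖ ≤ D * |t - s| ^ β)
    (hM : ∀ t ∈ Set.Icc (0 : ℝ) a, ‖z₁ t - z₂ t‖ ≤ M) :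
    ∀ s ∈ Set.Icc (0 : ℝ) a, ∀ t ∈ Set.Icc (0 : ℝ) a,
      ‖F (z₁ t) - F (z₂ t) - F (z₁ s) + F (z₂ s)‖ ≤
        (L / 2 * (H₁ + H₂) * M + L * r * D) * |t - s| ^ β := by
  intro s hs t ht
  have hM0 : 0 ≤ M := (norm_nonneg _).trans (hM t ht)
  have hH := add_le_add (hz₁hold s hs t ht) (hz₂hold s hs t ht)
  calc ‖F (z₁ t) - F (z₂ t) - F (z₁ s) + F (z₂ s)‖
      ≤ L / 2 * (‖z₁ t - z₁ s‖ + ‖z₂ t - z₂ s‖) * ‖z₁ t - z₂ t‖ +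
          L * r * ‖(z₁ t - z₂ t) - (z₁ s - z₂ s)‖ :=
        norm_sub_sub_add_le_of_lipschitz_fderiv hr.le hL hdiff hF'0 hlip
          (hz₁mem t ht) (hz₂mem t ht) (hz₁mem s hs) (hz₂mem s hs)
    _ ≤ L / 2 * (H₁ * |t - s| ^ β + H₂ * |t - s| ^ β) * M + L * r * (D * |t - s| ^ β) := by
        refine add_le_add (mul_le_mul (mul_le_mul_of_nonneg_left hH (by positivity)) (hM t ht)
          (norm_nonneg _) (mul_nonneg (by positivity) (le_trans (by positivity) hH)))
          (mul_le_mul_of_nonneg_left (hdifhold s hs t ht) (by positivity))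
    _ = _ := by ring
end

section
/- Let λ ∈ ℂ with Re λ ≥ 0 and λ ≠ 0, and let v : [0,∞) → ℂ be four times continuously differentiable with λ·v(y) + v''''(y) = 0 for all y ≥ 0, v'(0) = 0, v'''(0) = 0, and such that v(y), v'(y), v''(y), v'''(y) all tend to 0 as y → ∞. Then v(y) = 0 for all y ≥ 0. -/
open Filter

/-- Derivative of the energy flux `conj a * d - conj b * c`, where each of `a`, `b`, `c`, `d` is
the derivative of the preceding one. -/
theorem hasDerivWithinAt_energyFlux {a b c d : ℝ → ℂ} {e : ℂ} {s : Set ℝ} {y : ℝ}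
    (ha : HasDerivWithinAt a (b y) s y) (hb : HasDerivWithinAt b (c y) s y)
    (hc : HasDerivWithinAt c (d y) s y) (hd : HasDerivWithinAt d e s y) :
    HasDerivWithinAt (fun x => star (a x) * d x - star (b x) * c x)
      (star (a y) * e - star (c y) * c y) s y := by
  refine ((ha.star.mul hd).sub (hb.star.mul hc)).congr_deriv ?_
  ring

/-- A `C^n` function on `s` has iterated derivatives within `s` that are successive derivatives. -/
theorem ContDiffOn.hasDerivWithinAt_iteratedDerivWithin {E : Type*} [NormedAddCommGroup E]
    [NormedSpace ℝ E] {n : ℕ} {v : ℝ → E} {s : Set ℝ} (hv : ContDiffOn ℝ n v s)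
    (hs : UniqueDiffOn ℝ s) {k : ℕ} (hk : k < n) {y : ℝ} (hy : y ∈ s) :
    HasDerivWithinAt (iteratedDerivWithin k v s) (iteratedDerivWithin (k + 1) v s y) s y := by
  rw [iteratedDerivWithin_succ]
  exact (hv.differentiableOn_iteratedDerivWithin (by exact_mod_cast hk) hs y hy).hasDerivWithinAt

/-- A function on `[0,∞)` with nonpositive derivative that vanishes at `0` and at infinity
has zero derivative. -/
theorem deriv_eq_zero_of_nonpos_of_tendsto_zero {g g' : ℝ → ℝ}
    (hg : ∀ y ∈ Set.Ici (0 : ℝ), HasDerivWithinAt g (g' y) (Set.Ici 0) y)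
    (hg' : ∀ y ∈ Set.Ici (0 : ℝ), g' y ≤ 0) (h0 : g 0 = 0) (hlim : Tendsto g atTop (nhds 0))
    {y : ℝ} (hy : y ∈ Set.Ici (0 : ℝ)) : g' y = 0 := by
  have hanti : AntitoneOn g (Set.Ici 0) := by
    refine antitoneOn_of_hasDerivWithinAt_nonpos (convex_Ici 0)
      (fun x hx => (hg x hx).continuousWithinAt)
      (fun x hx => (hg x (interior_subset hx)).mono interior_subset)
      (fun x hx => hg' x (interior_subset hx))
  have hzero : ∀ x ∈ Set.Ici (0 : ℝ), g x = 0 := fun x hx => by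
    refine le_antisymm (h0 ▸ hanti Set.self_mem_Ici hx hx) (le_of_tendsto hlim ?_)
    filter_upwards [eventually_ge_atTop x] with z hz
    exact hanti hx (le_trans hx hz) hz
  exact (uniqueDiffOn_Ici 0 y hy).eq_deriv _ (hg y hy)
    ((hasDerivWithinAt_const y _ 0).congr hzero (hzero y hy))

/-- (Lopatinskii–Shapiro condition) For `Re λ ≥ 0`, `λ ≠ 0`, the only
solution of `λ v + v'''' = 0` on `[0,∞)` with `v'(0) = v'''(0) = 0` that vanishes at
infinity together with its derivatives is `v ≡ 0`. -/
theorem lopatinskii_shapiro_fourth_order_half_line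
    (lam : ℂ) (hlam : 0 ≤ lam.re) (hlam0 : lam ≠ 0) (v : ℝ → ℂ)
    (hv : ContDiffOn ℝ 4 v (Set.Ici 0))
    (hODE : ∀ y : ℝ, 0 ≤ y → lam * v y + iteratedDerivWithin 4 v (Set.Ici 0) y = 0)
    (hbc1 : derivWithin v (Set.Ici 0) 0 = 0)
    (hbc3 : iteratedDerivWithin 3 v (Set.Ici 0) 0 = 0)
    (hlim : ∀ k ≤ 3, Tendsto (iteratedDerivWithin k v (Set.Ici 0)) atTop (nhds 0)) :
    ∀ y : ℝ, 0 ≤ y → v y = 0 := by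
  have hs : UniqueDiffOn ℝ (Set.Ici (0 : ℝ)) := uniqueDiffOn_Ici 0
  set D : ℕ → ℝ → ℂ := fun k => iteratedDerivWithin k v (Set.Ici 0)
  have hder : ∀ k < 4, ∀ y ∈ Set.Ici (0 : ℝ),
      HasDerivWithinAt (D k) (D (k + 1) y) (Set.Ici 0) y := fun k hk y hy =>
    ContDiffOn.hasDerivWithinAt_iteratedDerivWithin (n := 4) (by exact_mod_cast hv) hs hk hy
  have hD0 : D 0 = v := iteratedDerivWithin_zero
  have hD1 : D 1 0 = 0 := by
    rw [← hbc1]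
    exact congrFun iteratedDerivWithin_one 0
  have hD3 : D 3 0 = 0 := hbc3
  have hD4 : ∀ y ∈ Set.Ici (0 : ℝ), D 4 y = -(lam * D 0 y) := fun y hy => by
    rw [hD0]
    exact eq_neg_of_add_eq_zero_right (hODE y hy)
  have hflux : ∀ y ∈ Set.Ici (0 : ℝ),
      HasDerivWithinAt (fun x => (star (D 0 x) * D 3 x - star (D 1 x) * D 2 x).re)
        (-(lam.re * Complex.normSq (D 0 y) + Complex.normSq (D 2 y))) (Set.Ici 0) y := by
    intro y hy
    have h := hasDerivWithinAt_energyFlux (hder 0 (by norm_num) y hy) (hder 1 (by norm_num) y hy)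
      (hder 2 (by norm_num) y hy) (hder 3 (by norm_num) y hy)
    refine (Complex.reCLM.hasFDerivAt.comp_hasDerivWithinAt y h).congr_deriv ?_
    simp [hD4 y hy, Complex.normSq_apply]
    ring
  have hfluxlim :
      Tendsto (fun x => (star (D 0 x) * D 3 x - star (D 1 x) * D 2 x).re) atTop (nhds 0) := by
    have hl : ∀ k ≤ 3, Tendsto (D k) atTop (nhds 0) := hlim
    have h := ((hl 0 (by norm_num)).star.mul (hl 3 le_rfl)).sub
      ((hl 1 (by norm_num)).star.mul (hl 2 (by norm_num)))
    rw [star_zero, zero_mul, sub_zero] at h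
    exact (Complex.continuous_re.tendsto 0).comp h
  have hzero : ∀ y ∈ Set.Ici (0 : ℝ), D 2 y = 0 := fun y hy => by
    have h := deriv_eq_zero_of_nonpos_of_tendsto_zero hflux
      (fun y _ => neg_nonpos.2 (add_nonneg (mul_nonneg hlam (Complex.normSq_nonneg _))
        (Complex.normSq_nonneg _))) (by simp [hD1, hD3]) hfluxlim hy
    have h1 := mul_nonneg hlam (Complex.normSq_nonneg (D 0 y))
    have h2 := Complex.normSq_nonneg (D 2 y)
    exact Complex.normSq_eq_zero.1 (by linarith)
  have hstep : ∀ k < 4, (∀ y ∈ Set.Ici (0 : ℝ), D k y = 0) →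
      ∀ y ∈ Set.Ici (0 : ℝ), D (k + 1) y = 0 := fun k hk h y hy =>
    (hs y hy).eq_deriv _ (hder k hk y hy)
      ((hasDerivWithinAt_const y _ 0).congr h (h y hy))
  intro y hy
  have h4 : D 4 y = 0 :=
    hstep 3 (by norm_num) (hstep 2 (by norm_num) hzero) y hy
  have h := hODE y hy
  change lam * v y + D 4 y = 0 at h
  rw [h4, add_zero] at h
  exact (mul_eq_zero.1 h).resolve_left hlam0
end

section
/- Let θ ∈ (0,π), l > 0, and set κ := −θ/l. Let u : ℝ → ℝ be four times continuously differentiable on [−l, l]. Then u satisfies u''''(x) + κ²·u''(x) = 0 for all x ∈ [−l, l], together with the boundary conditions u'(l) + κ(cot θ)u(l) = 0, −u'(−l) + κ(cot θ)u(−l) = 0, u'''(l) + κ²u'(l) = 0, and u'''(−l) + κ²u'(−l) = 0, if and only if there exist a, c ∈ ℝ such that u(x) = a·sin(κx) + c·(1 − cos θ · cos(κx)) for all x ∈ [−l, l]. -/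
/-- A function with vanishing derivative within a compact interval is constant on it. -/
theorem eq_of_hasDerivWithinAt_zero_Icc {a b : ℝ} {f : ℝ → ℝ}
    (hf : ∀ x ∈ Set.Icc a b, HasDerivWithinAt f 0 (Set.Icc a b) x)
    {x y : ℝ} (hx : x ∈ Set.Icc a b) (hy : y ∈ Set.Icc a b) : f x = f y := by
  have h := (convex_Icc a b).norm_image_sub_le_of_norm_hasDerivWithin_le (C := 0) hf
    (by simp) hy hx
  rw [zero_mul] at h
  exact sub_eq_zero.mp (norm_le_zero_iff.mp h)

theorem ContDiffOn.hasDerivWithinAt_iteratedDerivWithin_s9 {s : Set ℝ} {u : ℝ → ℝ} {n k : ℕ}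
    (hu : ContDiffOn ℝ n u s) (hs : UniqueDiffOn ℝ s) (hk : k < n) {x : ℝ} (hx : x ∈ s) :
    HasDerivWithinAt (iteratedDerivWithin k u s) (iteratedDerivWithin (k + 1) u s x) s x := by
  rw [iteratedDerivWithin_succ]
  exact (hu.differentiableOn_iteratedDerivWithin (by exact_mod_cast hk) hs x hx).hasDerivWithinAt

theorem eqOn_iteratedDerivWithin_succ {s : Set ℝ} (hs : UniqueDiffOn ℝ s) {u g g' : ℝ → ℝ} {k : ℕ}
    (h : Set.EqOn (iteratedDerivWithin k u s) g s) (hg : ∀ x, HasDerivAt g (g' x) x) :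
    Set.EqOn (iteratedDerivWithin (k + 1) u s) g' s := fun x hx => by
  rw [iteratedDerivWithin_succ, derivWithin_congr h (h hx)]
  exact (hg x).hasDerivWithinAt.derivWithin (hs x hx)

theorem hasDerivAt_add_mul_sin_add_mul_cos (d A B κ x : ℝ) :
    HasDerivAt (fun x => d + A * Real.sin (κ * x) + B * Real.cos (κ * x))
      (0 + -(κ * B) * Real.sin (κ * x) + κ * A * Real.cos (κ * x)) x := by
  have h : HasDerivAt (fun x : ℝ => κ * x) κ x := by simpa using (hasDerivAt_id x).const_mul κ
  refine (((h.sin.const_mul A).const_add d).add (h.cos.const_mul B)).congr_deriv ?_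
  ring

/-- Solutions of `u'' + κ² u = κ² d` on a compact interval are `d` plus a harmonic oscillation. -/
theorem exists_eq_add_sin_add_cos {a b κ d : ℝ} (hab : a ≤ b) (hκ : κ ≠ 0) {u v w : ℝ → ℝ}
    (hu : ∀ x ∈ Set.Icc a b, HasDerivWithinAt u (v x) (Set.Icc a b) x)
    (hv : ∀ x ∈ Set.Icc a b, HasDerivWithinAt v (w x) (Set.Icc a b) x)
    (hw : ∀ x ∈ Set.Icc a b, w x + κ ^ 2 * u x = κ ^ 2 * d) :
    ∃ A B : ℝ, ∀ x ∈ Set.Icc a b, u x = d + A * Real.sin (κ * x) + B * Real.cos (κ * x) := by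
  have hlin : ∀ x, HasDerivAt (fun x : ℝ => κ * x) κ x := fun x => by
    simpa using (hasDerivAt_id x).const_mul κ
  have hP : ∀ x ∈ Set.Icc a b, HasDerivWithinAt
      (fun x => κ * (u x - d) * Real.cos (κ * x) - v x * Real.sin (κ * x)) 0 (Set.Icc a b) x :=
    fun x hx => by
      refine (((((hu x hx).sub_const d).const_mul κ).mul (hlin x).cos.hasDerivWithinAt).sub
        ((hv x hx).mul (hlin x).sin.hasDerivWithinAt)).congr_deriv ?_
      linear_combination (-Real.sin (κ * x)) * hw x hx
  have hQ : ∀ x ∈ Set.Icc a b, HasDerivWithinAt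
      (fun x => κ * (u x - d) * Real.sin (κ * x) + v x * Real.cos (κ * x)) 0 (Set.Icc a b) x :=
    fun x hx => by
      refine (((((hu x hx).sub_const d).const_mul κ).mul (hlin x).sin.hasDerivWithinAt).add
        ((hv x hx).mul (hlin x).cos.hasDerivWithinAt)).congr_deriv ?_
      linear_combination (Real.cos (κ * x)) * hw x hx
  have ha : a ∈ Set.Icc a b := Set.left_mem_Icc.mpr hab
  refine ⟨(κ * (u a - d) * Real.sin (κ * a) + v a * Real.cos (κ * a)) / κ,
    (κ * (u a - d) * Real.cos (κ * a) - v a * Real.sin (κ * a)) / κ, fun x hx => ?_⟩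
  have hp := eq_of_hasDerivWithinAt_zero_Icc hP hx ha
  have hq := eq_of_hasDerivWithinAt_zero_Icc hQ hx ha
  rw [← hp, ← hq]
  field_simp
  linear_combination (-(κ * (u x - d))) * Real.sin_sq_add_cos_sq (κ * x)

/-- The null space of the linearized operator
`A₀ u = ∂ₓ²(∂ₓ² + κ²) u` with linearized angle and no-flux boundary conditions at
`x = ± l` is spanned by `sin (κ x)` and `1 - cos θ · cos (κ x)`, where `κ = -θ/l`. -/
theorem null_space_linearized_operator_lens
    (θ l : ℝ) (hθ : θ ∈ Set.Ioo 0 Real.pi) (hl : 0 < l)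
    (κ : ℝ) (hκ : κ = -θ / l) (u : ℝ → ℝ)
    (hu : ContDiffOn ℝ 4 u (Set.Icc (-l) l)) :
    ((∀ x ∈ Set.Icc (-l) l,
        iteratedDerivWithin 4 u (Set.Icc (-l) l) x
          + κ ^ 2 * iteratedDerivWithin 2 u (Set.Icc (-l) l) x = 0) ∧
      iteratedDerivWithin 1 u (Set.Icc (-l) l) l + κ * Real.cot θ * u l = 0 ∧
      -iteratedDerivWithin 1 u (Set.Icc (-l) l) (-l) + κ * Real.cot θ * u (-l) = 0 ∧
      iteratedDerivWithin 3 u (Set.Icc (-l) l) l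
        + κ ^ 2 * iteratedDerivWithin 1 u (Set.Icc (-l) l) l = 0 ∧
      iteratedDerivWithin 3 u (Set.Icc (-l) l) (-l)
        + κ ^ 2 * iteratedDerivWithin 1 u (Set.Icc (-l) l) (-l) = 0)
    ↔ ∃ a c : ℝ, ∀ x ∈ Set.Icc (-l) l,
        u x = a * Real.sin (κ * x) + c * (1 - Real.cos θ * Real.cos (κ * x)) := by
  obtain ⟨hθ0, hθπ⟩ := hθ
  have hsin : Real.sin θ ≠ 0 := (Real.sin_pos_of_pos_of_lt_pi hθ0 hθπ).ne'
  have hκ0 : κ ≠ 0 := by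
    rw [hκ]
    exact div_ne_zero (neg_ne_zero.mpr hθ0.ne') hl.ne'
  have hκl : κ * l = -θ := by rw [hκ, div_mul_cancel₀ _ hl.ne']
  have hκl' : κ * -l = θ := by linarith
  have hle : -l ≤ l := by linarith
  have hs : UniqueDiffOn ℝ (Set.Icc (-l) l) := uniqueDiffOn_Icc (by linarith)
  have hr : l ∈ Set.Icc (-l) l := Set.right_mem_Icc.mpr hle
  have hlft : -l ∈ Set.Icc (-l) l := Set.left_mem_Icc.mpr hle
  have hD : ∀ k : ℕ, k < 4 → ∀ x ∈ Set.Icc (-l) l, HasDerivWithinAt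
      (iteratedDerivWithin k u (Set.Icc (-l) l)) (iteratedDerivWithin (k + 1) u (Set.Icc (-l) l) x)
      (Set.Icc (-l) l) x := fun k hk x hx =>
    ContDiffOn.hasDerivWithinAt_iteratedDerivWithin_s9 (n := 4) hu hs hk hx
  have h0 : iteratedDerivWithin 0 u (Set.Icc (-l) l) = u := iteratedDerivWithin_zero
  have hderiv : ∀ d A B : ℝ,
      (∀ x ∈ Set.Icc (-l) l, u x = d + A * Real.sin (κ * x) + B * Real.cos (κ * x)) →
      Set.EqOn (iteratedDerivWithin 1 u (Set.Icc (-l) l))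
        (fun x => 0 + -(κ * B) * Real.sin (κ * x) + κ * A * Real.cos (κ * x))
        (Set.Icc (-l) l) := fun d A B h =>
    eqOn_iteratedDerivWithin_succ hs (k := 0) (by rw [h0]; exact h)
      (hasDerivAt_add_mul_sin_add_mul_cos d A B κ)
  constructor
  · rintro ⟨hode, hbr, -, hfr, -⟩
    have hflux : ∀ x ∈ Set.Icc (-l) l, iteratedDerivWithin 3 u (Set.Icc (-l) l) x
        + κ ^ 2 * iteratedDerivWithin 1 u (Set.Icc (-l) l) x = 0 := fun x hx => by
      rw [← hfr]
      refine eq_of_hasDerivWithinAt_zero_Icc (f := fun x =>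
        iteratedDerivWithin 3 u (Set.Icc (-l) l) x
          + κ ^ 2 * iteratedDerivWithin 1 u (Set.Icc (-l) l) x) (fun y hy => ?_) hx hr
      exact ((hD 3 (by norm_num) y hy).add ((hD 1 (by norm_num) y hy).const_mul _)).congr_deriv
        (hode y hy)
    have hcurv : ∀ x ∈ Set.Icc (-l) l,
        iteratedDerivWithin 2 u (Set.Icc (-l) l) x + κ ^ 2 * u x
          = iteratedDerivWithin 2 u (Set.Icc (-l) l) l + κ ^ 2 * u l := fun x hx => by
      refine eq_of_hasDerivWithinAt_zero_Icc (f := fun x =>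
        iteratedDerivWithin 2 u (Set.Icc (-l) l) x + κ ^ 2 * u x) (fun y hy => ?_) hx hr
      have hy0 := hD 0 (by norm_num) y hy
      rw [h0] at hy0
      exact ((hD 2 (by norm_num) y hy).add (hy0.const_mul _)).congr_deriv (hflux y hy)
    obtain ⟨d, hd⟩ : ∃ d, iteratedDerivWithin 2 u (Set.Icc (-l) l) l + κ ^ 2 * u l = κ ^ 2 * d :=
      ⟨_, (mul_div_cancel₀ _ (pow_ne_zero 2 hκ0)).symm⟩
    have hu' := hD 0 (by norm_num)
    rw [h0] at hu'
    obtain ⟨A, B, hAB⟩ := exists_eq_add_sin_add_cos hle hκ0 hu' (hD 1 (by norm_num))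
      (fun x hx => (hcurv x hx).trans hd)
    have hB : B = -d * Real.cos θ := by
      rw [hderiv d A B hAB hr, hAB l hr, Real.cot_eq_cos_div_sin] at hbr
      simp only [hκl, Real.sin_neg, Real.cos_neg] at hbr
      field_simp at hbr
      apply mul_left_cancel₀ hκ0
      linear_combination hbr - κ * B * Real.sin_sq_add_cos_sq θ
    refine ⟨A, d, fun x hx => ?_⟩
    rw [hAB x hx, hB]
    ring
  · rintro ⟨a, c, h⟩
    have hu0 : ∀ x ∈ Set.Icc (-l) l,
        u x = c + a * Real.sin (κ * x) + -(c * Real.cos θ) * Real.cos (κ * x) := fun x hx => by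
      rw [h x hx]
      ring
    have h1 := hderiv _ _ _ hu0
    have h2 := eqOn_iteratedDerivWithin_succ hs h1 (hasDerivAt_add_mul_sin_add_mul_cos _ _ _ κ)
    have h3 := eqOn_iteratedDerivWithin_succ hs h2 (hasDerivAt_add_mul_sin_add_mul_cos _ _ _ κ)
    have h4 := eqOn_iteratedDerivWithin_succ hs h3 (hasDerivAt_add_mul_sin_add_mul_cos _ _ _ κ)
    norm_num only at h2 h3 h4
    refine ⟨fun x hx => ?_, ?_, ?_, ?_, ?_⟩
    · rw [h4 hx, h2 hx]
      ring
    · rw [h1 hr, hu0 l hr, Real.cot_eq_cos_div_sin]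
      simp only [hκl, Real.sin_neg, Real.cos_neg]
      field_simp
      linear_combination (-c * Real.cos θ * κ) * Real.sin_sq_add_cos_sq θ
    · rw [h1 hlft, hu0 (-l) hlft, Real.cot_eq_cos_div_sin]
      simp only [hκl']
      field_simp
      linear_combination (-c * Real.cos θ * κ) * Real.sin_sq_add_cos_sq θ
    · rw [h3 hr, h1 hr]
      ring
    · rw [h3 hlft, h1 hlft]
      ring
end

section
/- Let θ ∈ (0,π), l > 0, and set κ := −θ/l. Let λ ∈ ℝ and let u : ℝ → ℝ be four times continuously differentiable on [−l, l] satisfying λ·u(x) = u''''(x) + κ²·u''(x) for all x ∈ [−l, l], together with the boundary conditions u'(l) + κ(cot θ)u(l) = 0, −u'(−l) + κ(cot θ)u(−l) = 0, u'''(l) + κ²u'(l) = 0, and u'''(−l) + κ²u'(−l) = 0. Then λ·I(u,u) = ∫_{−l}^{l} (u'''(x) + κ²u'(x))² dx, where I(u,u) := ∫_{−l}^{l} (u'(x))² dx − κ²∫_{−l}^{l} u(x)² dx + κ(cot θ)(u(l)² + u(−l)²). -/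
/-- On the interior of `[a, b]`, the iterated derivative of order `n + 1` within `[a, b]` is the
derivative of the one of order `n`. -/
theorem ContDiffOn.hasDerivAt_iteratedDerivWithin_Icc {u : ℝ → ℝ} {a b : ℝ} {m : ℕ}
    (hu : ContDiffOn ℝ m u (Set.Icc a b)) {n : ℕ} (hn : n < m) {x : ℝ} (hx : x ∈ Set.Ioo a b) :
    HasDerivAt (iteratedDerivWithin n u (Set.Icc a b))
      (iteratedDerivWithin (n + 1) u (Set.Icc a b) x) x := by
  have hd := hu.differentiableOn_iteratedDerivWithin (by exact_mod_cast hn)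
    (uniqueDiffOn_Icc (hx.1.trans hx.2)) x (Set.Ioo_subset_Icc_self hx)
  rw [iteratedDerivWithin_succ]
  exact hd.hasDerivWithinAt.hasDerivAt (Icc_mem_nhds hx.1 hx.2)


/-- Energy identity (equation (4.17)): if `λ u = u'''' + κ² u''` on
`[-l, l]` with the linearized angle and no-flux boundary conditions, then
`λ I(u,u) = ∫_{-l}^{l} (u''' + κ² u')²`, where
`I(u,u) = ∫ (u')² - κ² ∫ u² + κ (cot θ)(u(l)² + u(-l)²)`. -/
theorem energy_identity_lens_eigenvalue
    (θ l : ℝ) (hθ : θ ∈ Set.Ioo 0 Real.pi) (hl : 0 < l)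
    (κ : ℝ) (hκ : κ = -θ / l) (lam : ℝ) (u : ℝ → ℝ)
    (hu : ContDiffOn ℝ 4 u (Set.Icc (-l) l))
    (hODE : ∀ x ∈ Set.Icc (-l) l,
      lam * u x = iteratedDerivWithin 4 u (Set.Icc (-l) l) x
        + κ ^ 2 * iteratedDerivWithin 2 u (Set.Icc (-l) l) x)
    (hbc1 : iteratedDerivWithin 1 u (Set.Icc (-l) l) l + κ * Real.cot θ * u l = 0)
    (hbc2 : -iteratedDerivWithin 1 u (Set.Icc (-l) l) (-l) + κ * Real.cot θ * u (-l) = 0)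
    (hbc3 : iteratedDerivWithin 3 u (Set.Icc (-l) l) l
      + κ ^ 2 * iteratedDerivWithin 1 u (Set.Icc (-l) l) l = 0)
    (hbc4 : iteratedDerivWithin 3 u (Set.Icc (-l) l) (-l)
      + κ ^ 2 * iteratedDerivWithin 1 u (Set.Icc (-l) l) (-l) = 0) :
    lam * ((∫ x in (-l)..l, (iteratedDerivWithin 1 u (Set.Icc (-l) l) x) ^ 2)
        - κ ^ 2 * (∫ x in (-l)..l, (u x) ^ 2)
        + κ * Real.cot θ * ((u l) ^ 2 + (u (-l)) ^ 2))
      = ∫ x in (-l)..l, (iteratedDerivWithin 3 u (Set.Icc (-l) l) x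
          + κ ^ 2 * iteratedDerivWithin 1 u (Set.Icc (-l) l) x) ^ 2 := by
  set S := Set.Icc (-l) l with hS
  have hlt : -l < l := by linarith
  have hcont : ∀ n : ℕ, n ≤ 4 → ContinuousOn (iteratedDerivWithin n u S) S := fun n hn =>
    hu.continuousOn_iteratedDerivWithin (by exact_mod_cast hn) (uniqueDiffOn_Icc hlt)
  have c0 : ContinuousOn u S := hu.continuousOn
  have c1 := hcont 1 (by norm_num)
  have c2 := hcont 2 (by norm_num)
  have c3 := hcont 3 (by norm_num)
  have i1 : IntervalIntegrable (fun x => iteratedDerivWithin 1 u S x ^ 2)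
      MeasureTheory.volume (-l) l := (c1.pow 2).intervalIntegrable_of_Icc hlt.le
  have i0 : IntervalIntegrable (fun x => u x ^ 2)
      MeasureTheory.volume (-l) l := (c0.pow 2).intervalIntegrable_of_Icc hlt.le
  have i3 : IntervalIntegrable
      (fun x => (iteratedDerivWithin 3 u S x + κ ^ 2 * iteratedDerivWithin 1 u S x) ^ 2)
      MeasureTheory.volume (-l) l :=
    ((c3.add (c1.const_mul (κ ^ 2))).pow 2).intervalIntegrable_of_Icc hlt.le
  have hFTC := intervalIntegral.integral_eq_sub_of_hasDerivAt_of_le hlt.le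
    (f := fun x => lam * (u x * iteratedDerivWithin 1 u S x)
      - (iteratedDerivWithin 2 u S x + κ ^ 2 * u x)
        * (iteratedDerivWithin 3 u S x + κ ^ 2 * iteratedDerivWithin 1 u S x))
    (f' := fun x => lam * iteratedDerivWithin 1 u S x ^ 2 - lam * κ ^ 2 * u x ^ 2
      - (iteratedDerivWithin 3 u S x + κ ^ 2 * iteratedDerivWithin 1 u S x) ^ 2)
    (((c0.mul c1).const_mul lam).sub
      ((c2.add (c0.const_mul (κ ^ 2))).mul (c3.add (c1.const_mul (κ ^ 2)))))
    (fun x hx => by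
      have hd : ∀ n : ℕ, n < 4 → HasDerivAt (iteratedDerivWithin n u S)
          (iteratedDerivWithin (n + 1) u S x) x := fun n hn =>
        ContDiffOn.hasDerivAt_iteratedDerivWithin_Icc (m := 4) hu hn hx
      have d0 : HasDerivAt u (iteratedDerivWithin 1 u S x) x := by
        simpa only [iteratedDerivWithin_zero] using hd 0 (by norm_num)
      have d1 := hd 1 (by norm_num)
      have d2 := hd 2 (by norm_num)
      have d3 := hd 3 (by norm_num)
      refine (((d0.mul d1).const_mul lam).sub
        ((d2.add (d0.const_mul (κ ^ 2))).mul (d3.add (d1.const_mul (κ ^ 2))))).congr_deriv ?_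
      simp only [Pi.add_apply, Nat.reduceAdd]
      linear_combination (iteratedDerivWithin 2 u S x + κ ^ 2 * u x)
        * hODE x (Set.Ioo_subset_Icc_self hx))
    (((i1.const_mul lam).sub (i0.const_mul (lam * κ ^ 2))).sub i3)
  rw [intervalIntegral.integral_sub ((i1.const_mul lam).sub (i0.const_mul (lam * κ ^ 2))) i3,
    intervalIntegral.integral_sub (i1.const_mul lam) (i0.const_mul (lam * κ ^ 2)),
    intervalIntegral.integral_const_mul, intervalIntegral.integral_const_mul] at hFTC
  linear_combination hFTC + lam * u l * hbc1 + lam * u (-l) * hbc2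
    - (iteratedDerivWithin 2 u S l + κ ^ 2 * u l) * hbc3
    + (iteratedDerivWithin 2 u S (-l) + κ ^ 2 * u (-l)) * hbc4
end

section
/- Let θ ∈ (0,π) and r* > 0, and define σ, N : ℝ → ℝ² by σ(x) := (r*·sin(x/r*), r*·cos(x/r*) − r*·cos θ) and N(x) := (sin(x/r*), cos(x/r*)). Fix x ∈ ℝ and suppose ρ : ℝ² → ℝ is Fréchet differentiable at (0, r*) with ρ(0, r*) = 0, and that ‖σ(x) + ρ(a₁, r)·N(x) − (a₁, −r·cos θ)‖² = r² for all (a₁, r) in some neighborhood of (0, r*) in ℝ². Then the partial derivatives of ρ at (0, r*) satisfy ∂ρ/∂a₁(0, r*) = sin(x/r*) and ∂ρ/∂r(0, r*) = 1 − cos θ · cos(x/r*). -/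
/-- (Lemma 4.4, derivative computation) If `ρ(a₁, r)` is the
normal-graph height function implicitly defined by requiring `σ(x) + ρ N(x)` to lie on
the circle of radius `r` centered at `(a₁, -r cos θ)` (squared Euclidean distance
condition), with `ρ(0, r*) = 0` and `ρ` Fréchet differentiable at `(0, r*)`, then
`∂ρ/∂a₁(0, r*) = sin(x/r*)` and `∂ρ/∂r(0, r*) = 1 - cos θ · cos(x/r*)`. -/
theorem equilibria_parameterization_partial_derivatives
    (θ rs : ℝ) (hθ : θ ∈ Set.Ioo 0 Real.pi) (hrs : 0 < rs)
    (σ N : ℝ → ℝ × ℝ)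
    (hσ : ∀ x, σ x = (rs * Real.sin (x / rs), rs * Real.cos (x / rs) - rs * Real.cos θ))
    (hN : ∀ x, N x = (Real.sin (x / rs), Real.cos (x / rs)))
    (x : ℝ) (ρ : ℝ × ℝ → ℝ)
    (hρdiff : DifferentiableAt ℝ ρ (0, rs)) (hρ0 : ρ (0, rs) = 0)
    (hcond : ∀ᶠ p : ℝ × ℝ in nhds (0, rs),
      ((σ x).1 + ρ p * (N x).1 - p.1) ^ 2
        + ((σ x).2 + ρ p * (N x).2 + p.2 * Real.cos θ) ^ 2 = p.2 ^ 2) :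
    fderiv ℝ ρ (0, rs) (1, 0) = Real.sin (x / rs) ∧
    fderiv ℝ ρ (0, rs) (0, 1) = 1 - Real.cos θ * Real.cos (x / rs) := by
  have hL := hρdiff.hasFDerivAt
  have h₁ := (((hL.mul_const (N x).1).const_add (σ x).1).sub
    (hasFDerivAt_fst (𝕜 := ℝ) (p := ((0 : ℝ), rs)))).pow 2
  have h₂ := (((hL.mul_const (N x).2).const_add (σ x).2).add
    ((hasFDerivAt_snd (𝕜 := ℝ) (p := ((0 : ℝ), rs))).mul_const (Real.cos θ))).pow 2
  have h₃ := (hasFDerivAt_snd (𝕜 := ℝ) (p := ((0 : ℝ), rs))).pow 2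
  have heq := (h₁.add h₂).unique (h₃.congr_of_eventuallyEq hcond)
  have key (v : ℝ × ℝ) : fderiv ℝ ρ (0, rs) v
      = Real.sin (x / rs) * v.1 + (1 - Real.cos θ * Real.cos (x / rs)) * v.2 := by
    have hv := DFunLike.congr_fun heq v
    simp [hσ, hN, hρ0] at hv
    apply mul_left_cancel₀ hrs.ne'
    linear_combination hv / 2
      - rs * fderiv ℝ ρ (0, rs) v * Real.sin_sq_add_cos_sq (x / rs)
  constructor <;> simp [key]
end
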